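/- arXiv:2305.05123 — 2 statements merged into one kernel-verified Lean document; each statement's English description precedes it below -/
import Mathlib

section
/- Let H be a finite-dimensional complex Hilbert space with dim H ≥ 2. Every surjective map φ: P(H) → P(H) satisfying ‖φ(P) − φ(Q)‖ ≤ ‖P − Q‖ for all P, Q ∈ P(H) is a Wigner symmetry. -/
open scoped InnerProductSpace ComplexConjugate

variable {H : Type*} [NormedAddCommGroup H] [InnerProductSpace ℂ H] [CompleteSpace H]

/-- The rank-one (orthogonal) projection onto the span of a unit vector `v`,
i.e. `x ↦ ⟪v, x⟫ • v`. -/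
noncomputable def rankOneProj (v : H) : H →L[ℂ] H :=
  (innerSL ℂ v).smulRight v

/-- A rank-one projection: a self-adjoint idempotent bounded operator with
one-dimensional range. -/
def IsRankOneProjection (P : H →L[ℂ] H) : Prop :=
  IsSelfAdjoint P ∧ P ∘L P = P ∧ Module.finrank ℂ (LinearMap.range (P : H →ₗ[ℂ] H)) = 1

/-- `φ` is a Wigner symmetry: there is a unitary or antiunitary operator `U` on `H`
(an additive, norm-preserving, surjective map that is `ℂ`-linear or conjugate-linear)
such that `φ P = U P U*` for every rank-one projection `P`; equivalently, `φ` sends the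
projection onto `ℂv` to the projection onto `ℂ(Uv)` for every unit vector `v`. -/
def IsWignerSymmetry
    (φ : {P : H →L[ℂ] H // IsRankOneProjection P} → {P : H →L[ℂ] H // IsRankOneProjection P}) :
    Prop :=
  ∃ U : H → H,
    (∀ x y, U (x + y) = U x + U y) ∧
    (∀ x, ‖U x‖ = ‖x‖) ∧
    Function.Surjective U ∧
    ((∀ (c : ℂ) (x : H), U (c • x) = c • U x) ∨
      (∀ (c : ℂ) (x : H), U (c • x) = (starRingEnd ℂ) c • U x)) ∧
    (∀ (v : H), ‖v‖ = 1 → ∀ P : {P : H →L[ℂ] H // IsRankOneProjection P},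
      P.1 = rankOneProj v → (φ P).1 = rankOneProj (U v))

theorem dist_le_dist_map_of_surjective_nonexpansive {X : Type*} [PseudoMetricSpace X]
    [CompactSpace X] {φ : X → X} (hsurj : Function.Surjective φ)
    (hne : ∀ x y, dist (φ x) (φ y) ≤ dist x y) (x y : X) :
    dist x y ≤ dist (φ x) (φ y) := by
  have hit : ∀ n a b, dist (φ^[n] a) (φ^[n] b) ≤ dist a b := by
    intro n
    induction n with
    | zero => intro a b; exact le_rfl
    | succ n ih => intro a b; exact (ih _ _).trans (hne _ _)
  obtain ⟨ψ, hψ⟩ := hsurj.hasRightInverse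
  have hcancel : ∀ n a, φ^[n] (ψ^[n] a) = a := fun n => hψ.iterate n
  refine le_of_forall_pos_le_add fun ε hε => ?_
  obtain ⟨a, -, s, hs, hlim⟩ := isCompact_univ.tendsto_subseq
    (x := fun n : ℕ => (ψ^[n] x, ψ^[n] y)) (fun _ => Set.mem_univ _)
  obtain ⟨N, hN⟩ := Metric.cauchySeq_iff.1 hlim.cauchySeq (ε / 2) (half_pos hε)
  have hlt := hN N le_rfl (N + 1) (Nat.le_succ N)
  obtain ⟨k, hk⟩ := Nat.exists_eq_add_of_lt (hs (Nat.lt_succ_self N))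
  simp only [Function.comp, Prod.dist_eq, max_lt_iff] at hlt
  have hclose : ∀ z, dist (ψ^[s N] z) (ψ^[s (N + 1)] z) < ε / 2 →
      dist (φ z) (ψ^[k] z) < ε / 2 := by
    intro z hz
    have h1 := (hit (s N) _ _).trans_lt hz
    rw [hk, add_assoc, Function.iterate_add_apply, hcancel, hcancel] at h1
    have h2 := (hne _ _).trans_lt h1
    rwa [Function.iterate_succ_apply', hψ] at h2
  have hx := hclose x hlt.1
  have hy := hclose y hlt.2
  have h3 := hit k (ψ^[k] x) (ψ^[k] y)
  rw [hcancel, hcancel] at h3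
  have h4 := dist_triangle4_right (ψ^[k] x) (ψ^[k] y) (φ x) (φ y)
  rw [dist_comm (φ x)] at hx
  rw [dist_comm (φ y)] at hy
  linarith

omit [CompleteSpace H] in
theorem rankOneProj_apply (v x : H) : rankOneProj v x = ⟪v, x⟫_ℂ • v := rfl

theorem isSelfAdjoint_rankOneProj (v : H) : IsSelfAdjoint (rankOneProj v) := by
  rw [ContinuousLinearMap.isSelfAdjoint_iff_isSymmetric]
  intro x y
  simp only [ContinuousLinearMap.coe_coe, rankOneProj_apply, inner_smul_left, inner_smul_right,
    inner_conj_symm]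
  ring

theorem isRankOneProjection_rankOneProj {v : H} (hv : ‖v‖ = 1) :
    IsRankOneProjection (rankOneProj v) := by
  refine ⟨isSelfAdjoint_rankOneProj v, ?_, ?_⟩
  · ext x
    simp [rankOneProj_apply, hv]
  · have hrange : LinearMap.range (rankOneProj v : H →ₗ[ℂ] H) = ℂ ∙ v := by
      ext x
      rw [LinearMap.mem_range, Submodule.mem_span_singleton]
      constructor
      · rintro ⟨y, rfl⟩
        exact ⟨_, rfl⟩
      · rintro ⟨c, rfl⟩
        exact ⟨c • v, by simp [rankOneProj_apply, hv]⟩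
    rw [hrange]
    exact finrank_span_singleton (by rintro rfl; simp at hv)

theorem IsRankOneProjection.exists_eq_rankOneProj {P : H →L[ℂ] H} (hP : IsRankOneProjection P) :
    ∃ v : H, ‖v‖ = 1 ∧ P = rankOneProj v := by
  obtain ⟨hsa, hidem, hrank⟩ := hP
  obtain ⟨⟨w, hw⟩, hw0, hspan⟩ := finrank_eq_one_iff'.1 hrank
  have hw0' : w ≠ 0 := fun h => hw0 (Subtype.ext h)
  have hPw : P w = w := by
    obtain ⟨y, rfl⟩ := hw
    exact DFunLike.congr_fun hidem y
  have hn : (‖w‖ : ℂ) ≠ 0 := by simpa using hw0'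
  refine ⟨(‖w‖⁻¹ : ℂ) • w, by simp [norm_smul, hw0'], ?_⟩
  ext x
  obtain ⟨c, hc⟩ := hspan ⟨P x, x, rfl⟩
  have hc' : P x = c • w := (congrArg Subtype.val hc).symm
  have hsym := (ContinuousLinearMap.isSelfAdjoint_iff_isSymmetric.1 hsa) w x
  simp only [ContinuousLinearMap.coe_coe, hPw, hc', inner_smul_right,
    inner_self_eq_norm_sq_to_K] at hsym
  rw [rankOneProj_apply, inner_smul_left, hc', hsym, smul_smul]
  congr 1
  simp only [map_inv₀, Complex.conj_ofReal, Complex.coe_algebraMap]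
  field_simp

theorem norm_rankOneProj_sub_sq {u v : H} (hu : ‖u‖ = 1) (hv : ‖v‖ = 1) :
    ‖rankOneProj u - rankOneProj v‖ ^ 2 = 1 - ‖⟪u, v⟫_ℂ‖ ^ 2 := by
  set D := rankOneProj u - rankOneProj v
  have huu : ⟪u, u⟫_ℂ = 1 := inner_self_eq_one_of_norm_eq_one hu
  have hvv : ⟪v, v⟫_ℂ = 1 := inner_self_eq_one_of_norm_eq_one hv
  have hsa : IsSelfAdjoint D := (isSelfAdjoint_rankOneProj u).sub (isSelfAdjoint_rankOneProj v)
  have hmul : ⟪u, v⟫_ℂ * ⟪v, u⟫_ℂ = ((‖⟪u, v⟫_ℂ‖ ^ 2 : ℝ) : ℂ) := by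
    rw [← inner_conj_symm v u, Complex.mul_conj, Complex.normSq_eq_norm_sq]
  have hDx : ∀ x, D x = ⟪u, x⟫_ℂ • u - ⟪v, x⟫_ℂ • v := fun x => rfl
  have hquart : (D * D) * (D * D) = ((1 - ‖⟪u, v⟫_ℂ‖ ^ 2 : ℝ) : ℂ) • (D * D) := by
    ext x
    change D (D (D (D x))) = ((1 - ‖⟪u, v⟫_ℂ‖ ^ 2 : ℝ) : ℂ) • D (D x)
    rw [Complex.ofReal_sub, ← hmul]
    simp only [hDx, inner_smul_right, inner_sub_right, huu, hvv, Complex.ofReal_one]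
    module
  have hDu : ‖D u‖ ^ 2 = 1 - ‖⟪u, v⟫_ℂ‖ ^ 2 := by
    apply Complex.ofReal_injective
    have h := inner_self_eq_norm_sq_to_K (𝕜 := ℂ) (D u)
    rw [Complex.ofReal_sub, ← hmul, Complex.ofReal_pow]
    refine h.symm.trans ?_
    simp only [hDx, inner_smul_right, inner_smul_left, inner_sub_right, inner_sub_left, huu, hvv,
      Complex.ofReal_one, inner_conj_symm, map_one]
    ring
  have hnorm : ‖D‖ ^ 2 * ‖D‖ ^ 2 = (1 - ‖⟪u, v⟫_ℂ‖ ^ 2) * ‖D‖ ^ 2 := by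
    have h1 : ‖D * D‖ = ‖D‖ ^ 2 := by
      rw [sq]; nth_rewrite 1 [← hsa.star_eq]; exact CStarRing.norm_star_mul_self
    have h2 : ‖(D * D) * (D * D)‖ = ‖D * D‖ ^ 2 := by
      have : IsSelfAdjoint (D * D) := by simpa [hsa.star_eq] using IsSelfAdjoint.star_mul_self D
      rw [sq]; nth_rewrite 1 [← this.star_eq]; exact CStarRing.norm_star_mul_self
    rw [hquart, norm_smul, h1, Complex.norm_real, ← hDu, Real.norm_of_nonneg (sq_nonneg _),
      hDu] at h2
    rw [h2, sq (‖D‖ ^ 2)]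
  rcases eq_or_ne (‖D‖ ^ 2) 0 with h0 | h0
  · have hD0 : D = 0 := by simpa using h0
    rw [h0, ← hDu, hD0]
    simp
  · exact mul_right_cancel₀ h0 hnorm

theorem eq_or_eq_conj_of_norm_one_add_eq {a b s : ℂ} (hs : s = Complex.I ∨ s = conj Complex.I)
    (h : ‖b‖ = ‖a‖) (h1 : ‖1 + b‖ = ‖1 + a‖) (hI : ‖1 + b * star s‖ = ‖1 + a * star Complex.I‖) :
    (s = Complex.I → b = a) ∧ (s = conj Complex.I → b = conj a) := by
  have h2 := congrArg (· ^ 2) h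
  have h3 := congrArg (· ^ 2) h1
  have h4 := congrArg (· ^ 2) hI
  constructor <;> rintro rfl <;>
    simp [← Complex.normSq_eq_norm_sq, Complex.normSq_apply] at h2 h3 h4
  · exact Complex.ext (by linarith) (by linarith)
  · exact Complex.ext (by rw [Complex.conj_re]; linarith) (by rw [Complex.conj_im]; linarith)

theorem eq_I_or_eq_conj_I {s : ℂ} (h : ‖s‖ = 1) (h1 : ‖1 + s‖ = ‖1 + Complex.I‖) :
    s = Complex.I ∨ s = conj Complex.I := by
  have h2 := congrArg (· ^ 2) h
  have h3 := congrArg (· ^ 2) h1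
  simp [← Complex.normSq_eq_norm_sq, Complex.normSq_apply] at h2 h3
  have hre : s.re = 0 := by linarith
  have him : (s.im - 1) * (s.im + 1) = 0 := by rw [hre] at h2; linarith
  rcases mul_eq_zero.1 him with h4 | h4
  · exact Or.inl (Complex.ext (by simpa using hre) (by simp; linarith))
  · exact Or.inr (Complex.ext (by simpa using hre) (by simp; linarith))

open Matrix in
theorem exists_ringHom_of_norm_dotProduct_eq_of_normalized {ι : Type*} [Fintype ι] [DecidableEq ι]
    (o : ι) (S : (ι → ℂ) → ι → ℂ) (hone : ∀ v, v o = 1 → S v o = 1)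
    (hnorm : ∀ v, v o = 1 → ∀ i, ‖S v i‖ = ‖v i‖)
    (hdot : ∀ u v, u o = 1 → v o = 1 → ‖S v ⬝ᵥ star (S u)‖ = ‖v ⬝ᵥ star u‖)
    (hpair : ∀ j, S (Pi.single o 1 + Pi.single j 1) j = 1) :
    ∃ θ : ℂ →+* ℂ, (θ = RingHom.id ℂ ∨ θ = starRingEnd ℂ) ∧
      ∀ v, v o = 1 → S v = fun i => θ (v i) := by
  have hpt : ∀ j, j ≠ o → ∀ c : ℂ, (Pi.single o 1 + Pi.single j c : ι → ℂ) o = 1 := by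
    intro j hj c
    simp [hj.symm]
  have hSpt : ∀ j, j ≠ o → ∀ c : ℂ, S (Pi.single o 1 + Pi.single j c) =
      Pi.single o 1 + Pi.single j (S (Pi.single o 1 + Pi.single j c) j) := by
    intro j hj c
    ext i
    by_cases hio : i = o
    · subst hio
      simp [hone _ (hpt j hj c), hj.symm]
    by_cases hij : i = j
    · subst hij
      simp [hio]
    · have := hnorm _ (hpt j hj c) i
      simpa [hio, hij] using this
  have hinner : ∀ v, v o = 1 → ∀ j, j ≠ o → ∀ c : ℂ,
      ‖1 + S v j * star (S (Pi.single o 1 + Pi.single j c) j)‖ = ‖1 + v j * star c‖ := by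
    intro v hv j hj c
    have h := hdot _ v (hpt j hj c) hv
    rw [hSpt j hj c] at h
    simpa [dotProduct_add, star_add, hone v hv, hv] using h
  have hsplit : ∀ j, j ≠ o →
      (∀ v, v o = 1 → S v j = v j) ∨ (∀ v, v o = 1 → S v j = conj (v j)) := by
    intro j hj
    have h1 : ∀ v, v o = 1 → ‖1 + S v j‖ = ‖1 + v j‖ := by
      intro v hv
      simpa [hpair j] using hinner v hv j hj 1
    have hs : S (Pi.single o 1 + Pi.single j Complex.I) j = Complex.I ∨
        S (Pi.single o 1 + Pi.single j Complex.I) j = conj Complex.I := by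
      apply eq_I_or_eq_conj_I
      · simpa [hj] using hnorm _ (hpt j hj Complex.I) j
      · simpa [hj] using h1 _ (hpt j hj Complex.I)
    have key := fun v hv => eq_or_eq_conj_of_norm_one_add_eq hs (hnorm v hv j) (h1 v hv)
      (hinner v hv j hj Complex.I)
    exact hs.imp (fun h v hv => (key v hv).1 h) (fun h v hv => (key v hv).2 h)
  have hconsistent : ∀ j k, j ≠ o → k ≠ o → (∀ v, v o = 1 → S v j = v j) →
      (∀ v, v o = 1 → S v k = conj (v k)) → j = k := by
    intro j k hj hk hA hB
    by_contra hjk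
    set u : ι → ℂ := Pi.single o 1 + Pi.single j 1 + Pi.single k 1 with hu
    set w : ι → ℂ := Pi.single o 1 + Pi.single j Complex.I + Pi.single k Complex.I with hw
    have huo : u o = 1 := by simp [hu, hj.symm, hk.symm]
    have hwo : w o = 1 := by simp [hw, hj.symm, hk.symm]
    have hSu : S u = u := by
      ext i
      by_cases hio : i = o
      · rw [hio, hone u huo, huo]
      by_cases hij : i = j
      · rw [hij, hA u huo]
      by_cases hik : i = k
      · rw [hik, hB u huo]
        simp [hu, hk, Ne.symm hjk]
      · have := hnorm u huo i
        have hui : u i = 0 := by simp [hu, hio, hij, hik]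
        rw [hui] at this ⊢
        simpa using this
    have h := hdot u w huo hwo
    rw [hSu] at h
    simp [hu, dotProduct_add, star_add, hone w hwo, hwo, hA w hwo, hB w hwo] at h
    simp [hw, hj, hk, hjk, Ne.symm hjk] at h
    have h2 := congrArg (· ^ 2) h
    simp [← Complex.normSq_eq_norm_sq, Complex.normSq_apply] at h2
  by_cases hall : ∀ j, j ≠ o → ∀ v, v o = 1 → S v j = v j
  · refine ⟨RingHom.id ℂ, Or.inl rfl, fun v hv => funext fun i => ?_⟩
    by_cases hio : i = o
    · simp [hio, hone v hv, hv]
    · exact hall i hio v hv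
  · push Not at hall
    obtain ⟨j, hj, hnot⟩ := hall
    have hBj := (hsplit j hj).resolve_left fun h => by
      obtain ⟨v, hv, hne⟩ := hnot
      exact hne (h v hv)
    refine ⟨starRingEnd ℂ, Or.inr rfl, fun v hv => funext fun i => ?_⟩
    by_cases hio : i = o
    · simp [hio, hone v hv, hv]
    · rcases hsplit i hio with h | h
      · rw [hconsistent i j hio hj h hBj]
        exact hBj v hv
      · exact h v hv

open Matrix in
theorem exists_ringHom_of_norm_dotProduct_eq {ι : Type*} [Fintype ι] [DecidableEq ι]
    (o : ι) (T : (ι → ℂ) → ι → ℂ) (hnorm : ∀ v i, ‖T v i‖ = ‖v i‖)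
    (hdot : ∀ u v, ‖T v ⬝ᵥ star (T u)‖ = ‖v ⬝ᵥ star u‖)
    (hpair : ∀ j, T (Pi.single o 1 + Pi.single j 1) j = T (Pi.single o 1 + Pi.single j 1) o) :
    ∃ θ : ℂ →+* ℂ, (θ = RingHom.id ℂ ∨ θ = starRingEnd ℂ) ∧
      ∀ v, ‖T v ⬝ᵥ star (fun i => θ (v i))‖ = ‖v ⬝ᵥ star v‖ := by
  have hTo : ∀ v, v o = 1 → ‖T v o‖ = 1 := fun v hv => by rw [hnorm, hv, norm_one]
  have hTo0 : ∀ v, v o ≠ 0 → T v o ≠ 0 := fun v hv h => hv (by simpa [h] using (hnorm v o).symm)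
  obtain ⟨θ, hθ, hS⟩ := exists_ringHom_of_norm_dotProduct_eq_of_normalized o
    (fun v => (T v o)⁻¹ • T v)
    (fun v hv => by simp [hTo0 v (by simp [hv])])
    (fun v hv i => by simp [hTo v hv, hnorm])
    (fun u v hu hv => by simp [hTo u hu, hTo v hv, hdot])
    (fun j => by
      have : (Pi.single o 1 + Pi.single j 1 : ι → ℂ) o ≠ 0 := by
        by_cases h : j = o
        · subst h; norm_num
        · simp [Ne.symm h]
      simp [hpair j, hTo0 _ this])
  have hθnorm : ∀ c, ‖θ c‖ = ‖c‖ := by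
    rcases hθ with rfl | rfl <;> simp
  have hdotθ : ∀ u v, u o = 1 → ‖T v ⬝ᵥ star (fun i => θ (u i))‖ = ‖v ⬝ᵥ star u‖ := by
    intro u v hu
    rw [← hS u hu, ← hdot u v]
    simp [hTo u hu]
  refine ⟨θ, hθ, fun v => ?_⟩
  by_cases hv : v o = 0
  · have h := hdotθ (Pi.single o 1 + v) v (by simp [hv])
    have hadd : (fun i => θ ((Pi.single o 1 + v : ι → ℂ) i)) =
        Pi.single o 1 + fun i => θ (v i) := by
      ext i
      by_cases hio : i = o
      · subst hio; simp
      · simp [hio]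
    have hTv : T v o = 0 := by simpa [hv] using hnorm v o
    rw [hadd] at h
    simpa [star_add, dotProduct_add, hv, hTv] using h
  · have h := hdotθ ((v o)⁻¹ • v) v (by simp [hv])
    have hsmul : (fun i => θ (((v o)⁻¹ • v) i)) = (θ (v o))⁻¹ • fun i => θ (v i) := by
      ext i
      simp
    rw [hsmul] at h
    simpa [hθnorm, hv] using h

theorem rankOneProj_eq_of_norm_inner_eq_one {u v : H} (hu : ‖u‖ = 1) (hv : ‖v‖ = 1)
    (h : ‖⟪u, v⟫_ℂ‖ = 1) : rankOneProj u = rankOneProj v := by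
  have := norm_rankOneProj_sub_sq hu hv
  rw [h] at this
  simpa [sub_eq_zero] using this

theorem isCompact_setOf_isRankOneProjection [FiniteDimensional ℂ H] :
    IsCompact {P : H →L[ℂ] H | IsRankOneProjection P} := by
  have : ProperSpace H := FiniteDimensional.proper ℂ H
  have himage : {P : H →L[ℂ] H | IsRankOneProjection P} =
      rankOneProj '' Metric.sphere (0 : H) 1 := by
    ext P
    constructor
    · intro hP
      obtain ⟨v, hv, rfl⟩ := IsRankOneProjection.exists_eq_rankOneProj hP
      exact ⟨v, by simpa using hv, rfl⟩
    · rintro ⟨v, hv, rfl⟩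
      exact isRankOneProjection_rankOneProj (by simpa using hv)
  rw [himage]
  refine (isCompact_sphere _ _).image ?_
  change Continuous fun v : H => ContinuousLinearMap.smulRightL ℂ H H (innerSL ℂ v) v
  fun_prop

omit [CompleteSpace H] in
theorem norm_map_of_norm_inner_eq {T : H → H} (hT : ∀ x y, ‖⟪T x, T y⟫_ℂ‖ = ‖⟪x, y⟫_ℂ‖) (x : H) :
    ‖T x‖ = ‖x‖ := by
  have h := hT x x
  simp only [inner_self_eq_norm_sq_to_K, norm_pow, RCLike.norm_ofReal, abs_norm] at h
  exact (sq_eq_sq₀ (norm_nonneg _) (norm_nonneg _)).1 h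

theorem exists_vector_lift
    (φ : {P : H →L[ℂ] H // IsRankOneProjection P} → {P : H →L[ℂ] H // IsRankOneProjection P})
    (hφ : ∀ P Q, ‖(φ P).1 - (φ Q).1‖ = ‖P.1 - Q.1‖) :
    ∃ T : H → H, (∀ x y, ‖⟪T x, T y⟫_ℂ‖ = ‖⟪x, y⟫_ℂ‖) ∧
      ∀ v, ‖v‖ = 1 → ∀ P : {P : H →L[ℂ] H // IsRankOneProjection P},
        P.1 = rankOneProj v → (φ P).1 = rankOneProj (T v) := by
  have hunit : ∀ v : H, ∃ w : H, ‖v‖ = 1 → ‖w‖ = 1 ∧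
      ∀ P : {P : H →L[ℂ] H // IsRankOneProjection P},
        P.1 = rankOneProj v → (φ P).1 = rankOneProj w := by
    intro v
    by_cases hv : ‖v‖ = 1
    · obtain ⟨w, hw, hPw⟩ :=
        (φ ⟨rankOneProj v, isRankOneProjection_rankOneProj hv⟩).2.exists_eq_rankOneProj
      refine ⟨w, fun _ => ⟨hw, fun P hP => ?_⟩⟩
      rw [← hPw]
      congr
      exact Subtype.ext hP
    · exact ⟨0, fun h => absurd h hv⟩
  choose t ht using hunit
  have hinner : ∀ u v, ‖u‖ = 1 → ‖v‖ = 1 → ‖⟪t u, t v⟫_ℂ‖ = ‖⟪u, v⟫_ℂ‖ := by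
    intro u v hu hv
    have h := hφ ⟨rankOneProj u, isRankOneProjection_rankOneProj hu⟩
      ⟨rankOneProj v, isRankOneProjection_rankOneProj hv⟩
    rw [(ht u hu).2 _ rfl, (ht v hv).2 _ rfl] at h
    have h2 := congrArg (· ^ 2) h
    simp only [norm_rankOneProj_sub_sq hu hv,
      norm_rankOneProj_sub_sq (ht u hu).1 (ht v hv).1] at h2
    exact (sq_eq_sq₀ (norm_nonneg _) (norm_nonneg _)).1 (by linarith)
  have hnormalize : ∀ x : H, x ≠ 0 → ‖(‖x‖⁻¹ : ℂ) • x‖ = 1 := fun x hx => by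
    simp [norm_smul, hx]
  refine ⟨fun x => (‖x‖ : ℂ) • t ((‖x‖⁻¹ : ℂ) • x), fun x y => ?_, fun v hv P hP => ?_⟩
  · rcases eq_or_ne x 0 with rfl | hx
    · simp
    rcases eq_or_ne y 0 with rfl | hy
    · simp
    have h := hinner _ _ (hnormalize x hx) (hnormalize y hy)
    have hx' : ‖x‖ ≠ 0 := by simpa using hx
    have hy' : ‖y‖ ≠ 0 := by simpa using hy
    rw [inner_smul_left, inner_smul_right, norm_mul, norm_mul, h, inner_smul_left,
      inner_smul_right]
    simp
    field_simp
  · simpa [hv] using (ht v hv).2 P hP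

omit [CompleteSpace H] in
theorem exists_ringHom_orthonormalBasis_of_norm_inner_eq {ι : Type*} [Fintype ι] [DecidableEq ι]
    [FiniteDimensional ℂ H] (e : OrthonormalBasis ι ℂ H) (o : ι) (T : H → H)
    (hT : ∀ x y, ‖⟪T x, T y⟫_ℂ‖ = ‖⟪x, y⟫_ℂ‖) :
    ∃ (f : OrthonormalBasis ι ℂ H) (θ : ℂ →+* ℂ), (θ = RingHom.id ℂ ∨ θ = starRingEnd ℂ) ∧
      ∀ v, ‖⟪f.repr.symm (WithLp.toLp 2 fun i => θ (e.repr v i)), T v⟫_ℂ‖ = ‖⟪v, v⟫_ℂ‖ := by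
  have hself : ∀ j, ‖⟪T (e o), T (e o + e j)⟫_ℂ‖ = ‖⟪T (e j), T (e o + e j)⟫_ℂ‖ ∧
      ⟪T (e o), T (e o + e j)⟫_ℂ ≠ 0 := by
    intro j
    rw [← norm_ne_zero_iff, hT, hT]
    simp only [inner_add_right, orthonormal_iff_ite.1 e.orthonormal]
    by_cases h : o = j
    · subst h; norm_num
    · simp [h, Ne.symm h]
  let c : ι → ℂ := fun j => ⟪T (e j), T (e o + e j)⟫_ℂ / ⟪T (e o), T (e o + e j)⟫_ℂ
  have hc : ∀ j, ‖c j‖ = 1 := by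
    intro j
    rw [norm_div, ← (hself j).1, div_self (norm_ne_zero_iff.2 (hself j).2)]
  have hco : c o = 1 := div_self (hself o).2
  have horth : Orthonormal ℂ fun j => c j • T (e j) := by
    rw [orthonormal_iff_ite]
    intro i j
    rw [inner_smul_left, inner_smul_right]
    split_ifs with hij
    · subst hij
      have h1 : ‖T (e i)‖ = 1 := by rw [norm_map_of_norm_inner_eq hT, e.orthonormal.1]
      rw [inner_self_eq_one_of_norm_eq_one h1, mul_one, Complex.conj_mul', hc]
      norm_num
    · have h := hT (e i) (e j)
      rw [e.orthonormal.2 hij, norm_zero, norm_eq_zero] at h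
      simp [h]
  have hcard : Fintype.card ι = Module.finrank ℂ H :=
    (Module.finrank_eq_card_basis e.toBasis).symm
  let f : OrthonormalBasis ι ℂ H := OrthonormalBasis.mk horth
    (horth.linearIndependent.span_eq_top_of_card_eq_finrank' hcard).ge
  have hf : ∀ j, f j = c j • T (e j) := fun j => by simp [f]
  have hrepr : ∀ v j, f.repr v j = conj (c j) * ⟪T (e j), v⟫_ℂ := fun v j => by
    rw [f.repr_apply_apply, hf, inner_smul_left]
  obtain ⟨θ, hθ, h⟩ := exists_ringHom_of_norm_dotProduct_eq o
    (fun v => (f.repr (T (e.repr.symm (WithLp.toLp 2 v)))).ofLp)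
    (fun v i => by
      rw [hrepr, norm_mul, RCLike.norm_conj, hc, one_mul, hT, ← e.repr_apply_apply]
      simp)
    (fun u v => by
      rw [← EuclideanSpace.inner_eq_star_dotProduct, LinearIsometryEquiv.inner_map_map, hT,
        LinearIsometryEquiv.inner_map_map, EuclideanSpace.inner_eq_star_dotProduct])
    (fun j => by
      have hsum : e.repr.symm (WithLp.toLp 2 (Pi.single o 1 + Pi.single j 1)) = e o + e j := by
        rw [LinearIsometryEquiv.symm_apply_eq, map_add, e.repr_self, e.repr_self]
        rfl
      have hcj : ⟪T (e j), T (e o + e j)⟫_ℂ = c j * ⟪T (e o), T (e o + e j)⟫_ℂ :=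
        (div_mul_cancel₀ _ (hself j).2).symm
      rw [hsum, hrepr, hrepr, hco, hcj, ← mul_assoc, Complex.conj_mul', hc]
      simp)
  refine ⟨f, θ, hθ, fun v => ?_⟩
  rw [← f.repr.inner_map_map, ← e.repr.inner_map_map, EuclideanSpace.inner_eq_star_dotProduct,
    EuclideanSpace.inner_eq_star_dotProduct, LinearIsometryEquiv.apply_symm_apply]
  simpa using h (e.repr v).ofLp

/-- Corollary 1.2 (2). If `H` is finite-dimensional with `dim H ≥ 2`,
then every surjective nonexpansive map on the set of rank-one projections is a
Wigner symmetry. -/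
theorem finiteDimensional_surjective_nonexpansive_is_wigner
    [FiniteDimensional ℂ H] (hdim : 2 ≤ Module.finrank ℂ H)
    (φ : {P : H →L[ℂ] H // IsRankOneProjection P} → {P : H →L[ℂ] H // IsRankOneProjection P})
    (hsurj : Function.Surjective φ)
    (hne : ∀ P Q : {P : H →L[ℂ] H // IsRankOneProjection P},
      ‖(φ P).1 - (φ Q).1‖ ≤ ‖P.1 - Q.1‖) :
    IsWignerSymmetry φ := by
  have : CompactSpace {P : H →L[ℂ] H // IsRankOneProjection P} :=
    isCompact_iff_compactSpace.1 isCompact_setOf_isRankOneProjection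
  have hdist : ∀ P Q : {P : H →L[ℂ] H // IsRankOneProjection P}, dist P Q = ‖P.1 - Q.1‖ :=
    fun P Q => by rw [Subtype.dist_eq, dist_eq_norm]
  have hisom : ∀ P Q, ‖(φ P).1 - (φ Q).1‖ = ‖P.1 - Q.1‖ := by
    intro P Q
    refine le_antisymm (hne P Q) ?_
    rw [← hdist, ← hdist]
    exact dist_le_dist_map_of_surjective_nonexpansive hsurj
      (fun P Q => by rw [hdist, hdist]; exact hne P Q) P Q
  obtain ⟨T, hT, hφT⟩ := exists_vector_lift φ hisom
  obtain ⟨f, θ, hθ, hfθ⟩ := exists_ringHom_orthonormalBasis_of_norm_inner_eq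
    (stdOrthonormalBasis ℂ H) ⟨0, by lia⟩ T hT
  set e := stdOrthonormalBasis ℂ H
  have hθnorm : ∀ c, ‖θ c‖ = ‖c‖ := by
    rcases hθ with rfl | rfl <;> simp
  have hθinv : ∀ c, θ (θ c) = c := by
    rcases hθ with rfl | rfl <;> simp
  have hnormU : ∀ x, ‖f.repr.symm (WithLp.toLp 2 fun i => θ (e.repr x i))‖ = ‖x‖ := by
    intro x
    rw [LinearIsometryEquiv.norm_map, ← e.repr.norm_map x, EuclideanSpace.norm_eq,
      EuclideanSpace.norm_eq]
    simp [hθnorm]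
  have haddU : ∀ x y : H, f.repr.symm (WithLp.toLp 2 fun i => θ (e.repr (x + y) i)) =
      f.repr.symm (WithLp.toLp 2 fun i => θ (e.repr x i)) +
        f.repr.symm (WithLp.toLp 2 fun i => θ (e.repr y i)) := by
    intro x y
    rw [← map_add, ← WithLp.toLp_add]
    congr 2
    ext i
    simp
  have hsmulU : ∀ (c : ℂ) (x : H), f.repr.symm (WithLp.toLp 2 fun i => θ (e.repr (c • x) i)) =
      θ c • f.repr.symm (WithLp.toLp 2 fun i => θ (e.repr x i)) := by
    intro c x
    rw [← map_smul, ← WithLp.toLp_smul]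
    congr 2
    ext i
    simp
  refine ⟨fun x => f.repr.symm (WithLp.toLp 2 fun i => θ (e.repr x i)), haddU, hnormU,
    fun y => ?_, ?_, fun v hv P hP => ?_⟩
  · refine ⟨e.repr.symm (WithLp.toLp 2 fun i => θ (f.repr y i)), ?_⟩
    simp [hθinv]
  · rcases hθ with rfl | rfl
    · exact Or.inl hsmulU
    · exact Or.inr hsmulU
  · rw [hφT v hv P hP]
    have hTv : ‖T v‖ = 1 := (norm_map_of_norm_inner_eq hT v).trans hv
    refine (rankOneProj_eq_of_norm_inner_eq_one ((hnormU v).trans hv) hTv ?_).symm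
    rw [hfθ v]
    simp [hv]
end

section
/- Let φ: P(H) → P(H) satisfy ‖φ(P) − φ(Q)‖ ≤ ‖P − Q‖ for all P, Q ∈ P(H), let n be a positive integer, let {P_1, …, P_n} ⊆ P(H) be an OSP, and let Q_1, …, Q_n ∈ P(H) satisfy φ(Q_j) = P_j for j = 1, …, n. Then for every Q ∈ P(H), if Q ≤ Q_1 + ⋯ + Q_n (in the Löwner order on self-adjoint operators), then φ(Q) ≤ P_1 + ⋯ + P_n. -/
open scoped InnerProductSpace ComplexConjugate

variable {H : Type*} [NormedAddCommGroup H] [InnerProductSpace ℂ H] [CompleteSpace H]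

/-- The Löwner order on self-adjoint bounded operators: `A ≤ B` iff `B − A` is positive. -/
def LoewnerLE (A B : H →L[ℂ] H) : Prop := (B - A).IsPositive

theorem IsRankOneProjection.exists_unit_vector {P : H →L[ℂ] H} (hP : IsRankOneProjection P) :
    ∃ e : H, ‖e‖ = 1 ∧ ∀ x, P x = ⟪e, x⟫_ℂ • e := by
  obtain ⟨hsa, hid, hrank⟩ := hP
  obtain ⟨⟨v, hv⟩, hv0, hspan⟩ := finrank_eq_one_iff'.mp hrank
  have hvne : v ≠ 0 := fun h => hv0 (Subtype.ext h)
  have hPv : P v = v := by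
    obtain ⟨w, rfl⟩ := hv
    exact congrArg (fun T : H →L[ℂ] H => T w) hid
  have hnorm : (‖v‖ : ℂ) ≠ 0 := by simpa using hvne
  refine ⟨(‖v‖ : ℂ)⁻¹ • v, by simp [norm_smul, hvne], fun x => ?_⟩
  obtain ⟨c, hc⟩ := hspan ⟨P x, x, rfl⟩
  have hc : c • v = P x := congrArg Subtype.val hc
  have hinner : ⟪v, x⟫_ℂ = c * (‖v‖ : ℂ) ^ 2 := by
    calc ⟪v, x⟫_ℂ = ⟪P v, x⟫_ℂ := by rw [hPv]
      _ = ⟪v, P x⟫_ℂ := hsa.isSymmetric v x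
      _ = c * (‖v‖ : ℂ) ^ 2 := by
        rw [← hc, inner_smul_right, inner_self_eq_norm_sq_to_K]; rfl
  rw [← hc, inner_smul_left, hinner, smul_smul]
  congr 1
  simp only [map_inv₀, Complex.conj_ofReal]
  field_simp

theorem one_sub_norm_inner_sq_le {E : Type*} [NormedAddCommGroup E] [InnerProductSpace ℂ E]
    {P Q : E →L[ℂ] E} {e f : E} (he : ‖e‖ = 1) (hf : ‖f‖ = 1)
    (hP : ∀ x, P x = ⟪e, x⟫_ℂ • e) (hQ : ∀ x, Q x = ⟪f, x⟫_ℂ • f) :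
    1 - ‖⟪f, e⟫_ℂ‖ ^ 2 ≤ ‖P - Q‖ ^ 2 := by
  have hle : ‖(P - Q) e‖ ≤ ‖P - Q‖ := by simpa [he] using (P - Q).le_opNorm e
  have heq : ‖(P - Q) e‖ ^ 2 = 1 - ‖⟪f, e⟫_ℂ‖ ^ 2 := by
    have hPe : P e = e := by simp [hP, inner_self_eq_norm_sq_to_K, he]
    rw [sub_apply, hPe, hQ, @norm_sub_sq ℂ, inner_smul_right,
      norm_smul, he, hf, ← inner_conj_symm e f, Complex.mul_conj, Complex.normSq_eq_norm_sq]
    simp only [RCLike.re_to_complex, Complex.ofReal_re]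
    ring
  rw [← heq]
  gcongr

theorem norm_sub_sq_le_one_sub {P Q : H →L[ℂ] H} (hPr : IsRankOneProjection P)
    (hQr : IsRankOneProjection Q) {e f : H} (he : ‖e‖ = 1) (hf : ‖f‖ = 1)
    (hP : ∀ x, P x = ⟪e, x⟫_ℂ • e) (hQ : ∀ x, Q x = ⟪f, x⟫_ℂ • f) :
    ‖P - Q‖ ^ 2 ≤ 1 - ‖⟪f, e⟫_ℂ‖ ^ 2 := by
  set s : ℝ := 1 - ‖⟪f, e⟫_ℂ‖ ^ 2 with hs
  have hs0 : 0 ≤ s := by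
    have h := norm_inner_le_norm (𝕜 := ℂ) f e
    rw [he, hf] at h
    nlinarith [norm_nonneg ⟪f, e⟫_ℂ]
  have hPP : P * P = P := hPr.2.1
  have hQQ : Q * Q = Q := hQr.2.1
  have hsC : (s : ℂ) = 1 - ⟪f, e⟫_ℂ * ⟪e, f⟫_ℂ := by
    rw [← inner_conj_symm e f, Complex.mul_conj, Complex.normSq_eq_norm_sq, hs]
    push_cast
    rfl
  have hPQP : P * Q * P = (1 - (s : ℂ)) • P := by
    ext x
    simp only [mul_apply_eq_comp, smul_apply, hP, hQ,
      inner_smul_right, smul_smul, hsC]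
    congr 1
    ring
  have hQPQ : Q * P * Q = (1 - (s : ℂ)) • Q := by
    ext x
    simp only [mul_apply_eq_comp, smul_apply, hP, hQ,
      inner_smul_right, smul_smul, hsC]
    congr 1
    ring
  have hcube : (P - Q) * (P - Q) * (P - Q) = (s : ℂ) • (P - Q) := by
    have hexp : (P - Q) * (P - Q) * (P - Q) = P * P * P - P * P * Q - P * Q * P + P * (Q * Q)
        - Q * (P * P) + Q * P * Q + Q * Q * P - Q * Q * Q := by noncomm_ring
    rw [hexp]
    simp only [hPP, hQQ, hPQP, hQPQ]
    module
  have hsa : IsSelfAdjoint (P - Q) := hPr.1.sub hQr.1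
  have hsq : ‖(P - Q) * (P - Q)‖ = ‖P - Q‖ ^ 2 := by
    exact hsa.norm_mul_self
  have hsa' : IsSelfAdjoint ((P - Q) * (P - Q)) := by
    simpa [sq] using hsa.pow 2
  have hfour : (‖P - Q‖ ^ 2) ^ 2 = s * ‖P - Q‖ ^ 2 := by
    have h : ‖((P - Q) * (P - Q)) * ((P - Q) * (P - Q))‖ = ‖(P - Q) * (P - Q)‖ ^ 2 := by
      exact hsa'.norm_mul_self
    rw [← hsq, ← h, ← mul_assoc, hcube, smul_mul_assoc, norm_smul, Complex.norm_real,
      Real.norm_of_nonneg hs0]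
  rcases (sq_nonneg ‖P - Q‖).eq_or_lt with h | h
  · rw [← h]; exact hs0
  · nlinarith

theorem re_inner_apply_self_eq {E : Type*} [NormedAddCommGroup E] [InnerProductSpace ℂ E]
    {Q : E →L[ℂ] E} {f : E} (hQ : ∀ x, Q x = ⟪f, x⟫_ℂ • f) (x : E) :
    (⟪Q x, x⟫_ℂ).re = ‖⟪f, x⟫_ℂ‖ ^ 2 := by
  rw [hQ, inner_smul_left, mul_comm, Complex.mul_conj, Complex.normSq_eq_norm_sq,
    Complex.ofReal_re]

/-- A star projection dominates a rank-one projection onto `v` as soon as its quadratic form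
is at least `1` at the unit vector `v`. -/
theorem loewnerLE_of_one_le_re_inner {S V : H →L[ℂ] H} (hS : IsStarProjection S)
    (hVr : IsRankOneProjection V) {v : H} (hv : ‖v‖ = 1) (hV : ∀ x, V x = ⟪v, x⟫_ℂ • v)
    (h : 1 ≤ (⟪S v, v⟫_ℂ).re) : LoewnerLE V S := by
  have hSS : S (S v) = S v := congrArg (fun T : H →L[ℂ] H => T v) hS.isIdempotentElem.eq
  have hSv : S v = v := by
    have hnorm : ‖S v‖ ^ 2 = (⟪S v, v⟫_ℂ).re := by
      have h1 : ⟪S v, S v⟫_ℂ = ⟪S v, v⟫_ℂ := by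
        calc ⟪S v, S v⟫_ℂ = ⟪S (S v), v⟫_ℂ := (hS.isSelfAdjoint.isSymmetric (S v) v).symm
          _ = ⟪S v, v⟫_ℂ := by rw [hSS]
      rw [← h1, inner_self_eq_norm_sq_to_K]
      norm_cast
    have h2 : ‖S v - v‖ ^ 2 ≤ 0 := by
      rw [@norm_sub_sq ℂ, hnorm, hv]
      simp only [RCLike.re_to_complex]
      linarith
    exact sub_eq_zero.mp (norm_eq_zero.mp (pow_eq_zero_iff two_ne_zero |>.mp
      (le_antisymm h2 (sq_nonneg _))))
  have hSV : S * V = V := by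
    ext x
    simp [hV, hSv]
  have hVS : V * S = V := by
    have h3 := congrArg star hSV
    rwa [star_mul, hVr.1.star_eq, hS.isSelfAdjoint.star_eq] at h3
  have hVV : V * V = V := hVr.2.1
  have hproj : IsStarProjection (S - V) := by
    refine ⟨?_, hS.isSelfAdjoint.sub hVr.1⟩
    rw [IsIdempotentElem, sub_mul, mul_sub, mul_sub, hS.isIdempotentElem.eq, hSV, hVS, hVV]
    simp
  exact ContinuousLinearMap.IsPositive.of_isStarProjection hproj

theorem isStarProjection_sum {ι : Type*} [Fintype ι] {P : ι → H →L[ℂ] H}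
    (hP : ∀ i, IsRankOneProjection (P i)) (hOSP : ∀ i j, i ≠ j → P i ∘L P j = 0) :
    IsStarProjection (∑ i, P i) := by
  refine ⟨?_, isSelfAdjoint_sum _ fun i _ => (hP i).1⟩
  rw [IsIdempotentElem, Finset.sum_mul_sum]
  refine Finset.sum_congr rfl fun i _ => ?_
  exact (Finset.sum_eq_single i (fun j _ hji => hOSP i j hji.symm) (by simp)).trans (hP i).2.1

/-- second part of Lemma 2.3. Let `φ` be nonexpansive on the set of rank-one
projections, let `{P_1, …, P_n}` be an orthogonal system of rank-one projections, and let
`Q_1, …, Q_n` satisfy `φ (Q j) = P j`. Then for every rank-one projection `Q`, if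
`Q ≤ Q_1 + ⋯ + Q_n` in the Löwner order then `φ(Q) ≤ P_1 + ⋯ + P_n`. -/
theorem nonexpansive_dominated_by_sum
    (φ : {P : H →L[ℂ] H // IsRankOneProjection P} → {P : H →L[ℂ] H // IsRankOneProjection P})
    (hne : ∀ P Q : {P : H →L[ℂ] H // IsRankOneProjection P},
      ‖(φ P).1 - (φ Q).1‖ ≤ ‖P.1 - Q.1‖)
    (n : ℕ) (hn : 0 < n)
    (P Q : Fin n → {P : H →L[ℂ] H // IsRankOneProjection P})
    (hOSP : ∀ i j, i ≠ j → (P i).1 ∘L (P j).1 = 0)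
    (hpre : ∀ j, φ (Q j) = P j) :
    ∀ R : {P : H →L[ℂ] H // IsRankOneProjection P},
      LoewnerLE R.1 (∑ j, (Q j).1) → LoewnerLE (φ R).1 (∑ j, (P j).1) := by
  intro R hR
  choose e he hPe using fun j => (P j).2.exists_unit_vector
  choose f hf hQf using fun j => (Q j).2.exists_unit_vector
  obtain ⟨r, hr, hRr⟩ := R.2.exists_unit_vector
  obtain ⟨v, hv, hVv⟩ := (φ R).2.exists_unit_vector
  refine loewnerLE_of_one_le_re_inner (isStarProjection_sum (fun j => (P j).2) hOSP)
    (φ R).2 hv hVv ?_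
  have hmono : ∀ j, ‖⟪f j, r⟫_ℂ‖ ^ 2 ≤ ‖⟪e j, v⟫_ℂ‖ ^ 2 := by
    intro j
    have h1 := one_sub_norm_inner_sq_le hv (he j) hVv (hPe j)
    have h2 := norm_sub_sq_le_one_sub R.2 (Q j).2 hr (hf j) hRr (hQf j)
    have h3 := pow_le_pow_left₀ (norm_nonneg _) (hne R (Q j)) 2
    rw [hpre j] at h3
    linarith
  have hpos : 0 ≤ (⟪(∑ j, (Q j).1 - R.1) r, r⟫_ℂ).re := hR.re_inner_nonneg_left r
  rw [sub_apply, inner_sub_left, Complex.sub_re,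
    re_inner_apply_self_eq hRr, inner_self_eq_norm_sq_to_K, hr, sum_apply,
    sum_inner, Complex.re_sum] at hpos
  simp only [fun j => re_inner_apply_self_eq (hQf j) r] at hpos
  rw [sum_apply, sum_inner, Complex.re_sum]
  simp only [fun j => re_inner_apply_self_eq (hPe j) v]
  have hsum := Finset.sum_le_sum fun j (_ : j ∈ Finset.univ) => hmono j
  norm_num at hpos
  linarith
end
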